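/- Let 0 < q < 1 be real, let ν be a real number that is not a negative integer, and let z be real with 0 < z < 2q/(1−q²). Then f(z) = I^{(1)}_ν((1−q²)z; q²) satisfies the second-order q-difference equation [1 − q^{−2}(1−q²)² z²/4]·f(q^{−1}z) − (q^{−ν} + q^{ν})·f(z) + f(qz) = 0. -/

import Mathlib

/-- The finite q-Pochhammer symbol `(a;q)_n = ∏_{j=0}^{n-1} (1 - a q^j)` (real version). -/
noncomputable def qPochR (a q : ℝ) (n : ℕ) : ℝ := ∏ j ∈ Finset.range n, (1 - a * q ^ j)

/-- The infinite q-Pochhammer symbol `(a;q)_∞ = ∏_{j=0}^{∞} (1 - a q^j)` (real version). -/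
noncomputable def qPochInfR (a q : ℝ) : ℝ := ∏' j : ℕ, (1 - a * q ^ j)

/-- The q²-Gamma function `Γ_{q²}(s) = ((q²;q²)_∞ / (q^{2s};q²)_∞) (1-q²)^{1-s}`,
with `q^{2s} = exp(2s ln q)`. -/
noncomputable def qGamma2 (q s : ℝ) : ℝ :=
  (qPochInfR (q ^ 2) (q ^ 2) / qPochInfR (Real.exp (2 * s * Real.log q)) (q ^ 2)) *
    (1 - q ^ 2) ^ (1 - s)

/-- The first modified q-Bessel function:
`I¹ q ν z = I^{(1)}_ν((1-q²)z; q²) = ∑_{k=0}^∞ (1-q²)^k (z/2)^{ν+2k} / ((q²;q²)_k Γ_{q²}(ν+k+1))`. -/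
noncomputable def I1 (q ν z : ℝ) : ℝ :=
  ∑' k : ℕ, (1 - q ^ 2) ^ k * (z / 2) ^ (ν + 2 * (k : ℝ)) /
    (qPochR (q ^ 2) (q ^ 2) k * qGamma2 q (ν + k + 1))

/-- The second modified q-Bessel function:
`I² q ν z = I^{(2)}_ν((1-q²)z; q²)
  = ∑_{k=0}^∞ q^{2k(ν+k)} (1-q²)^k (z/2)^{ν+2k} / ((q²;q²)_k Γ_{q²}(ν+k+1))`. -/
noncomputable def I2 (q ν z : ℝ) : ℝ :=
  ∑' k : ℕ, q ^ (2 * (k : ℝ) * (ν + k)) * (1 - q ^ 2) ^ k * (z / 2) ^ (ν + 2 * (k : ℝ)) /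
    (qPochR (q ^ 2) (q ^ 2) k * qGamma2 q (ν + k + 1))

/-- The q-derivative `∂_q f(z) = (f(z) - f(qz)) / ((1-q)z)`. -/
noncomputable def qDeriv (q : ℝ) (f : ℝ → ℝ) (z : ℝ) : ℝ := (f z - f (q * z)) / ((1 - q) * z)

lemma aux_one (q s : ℝ) (hq0 : 0 < q) (hq1 : q < 1) (h : q ^ s = 1) : s = 0 := by
  have h2 := congrArg Real.log h
  rw [Real.log_rpow hq0, Real.log_one] at h2
  rcases mul_eq_zero.1 h2 with h3 | h3
  · exact h3
  · exact absurd h3 (Real.log_neg hq0 hq1).ne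

lemma aux_poch (a r : ℝ) (hr0 : 0 < r) (hr1 : r < 1) :
    qPochInfR a r = (1 - a) * qPochInfR (a * r) r := by
  have hs : Summable (fun j : ℕ => -(a * r * r ^ j)) :=
    ((summable_geometric_of_lt_one hr0.le hr1).mul_left (a * r)).neg
  have hm : Multipliable (fun j : ℕ => 1 + -(a * r * r ^ j)) :=
    Real.multipliable_one_add_of_summable hs
  have he : (fun j : ℕ => 1 + -(a * r * r ^ j)) = fun j : ℕ => (fun i : ℕ => 1 - a * r ^ i) (j + 1) := by
    funext j
    simp only [pow_succ]
    ring
  have he2 : (fun j : ℕ => 1 + -(a * r * r ^ j)) = fun j : ℕ => 1 - (a * r) * r ^ j := by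
    funext j
    ring
  have h3 := tprod_eq_zero_mul' (f := fun i : ℕ => 1 - a * r ^ i) (he ▸ hm)
  rw [← he, he2] at h3
  simpa [qPochInfR] using h3

lemma aux_gamma (q s : ℝ) (hq0 : 0 < q) (hq1 : q < 1) (hs : s ≠ 0) :
    (qGamma2 q (s + 1))⁻¹ = (qGamma2 q s)⁻¹ * ((1 - q ^ 2) / (1 - q ^ (2 * s))) := by
  have hq2 : q ^ 2 < 1 := by nlinarith
  have e1 : Real.exp (2 * s * Real.log q) = q ^ (2 * s) := by
    rw [Real.rpow_def_of_pos hq0]; ring_nf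
  have e2 : Real.exp (2 * (s + 1) * Real.log q) = q ^ (2 * s) * q ^ 2 := by
    rw [← Real.rpow_natCast q 2, ← Real.rpow_add hq0, Real.rpow_def_of_pos hq0]
    congr 1; push_cast; ring
  have hne : 1 - q ^ (2 * s) ≠ 0 := by
    intro h
    have h' : q ^ (2 * s) = 1 := by linarith
    exact hs (by linarith [aux_one q _ hq0 hq1 h'])
  unfold qGamma2
  rw [e1, e2, aux_poch (q ^ (2 * s)) (q ^ 2) (by positivity) hq2]
  have e3 : (1 - q ^ 2) ^ (1 - s) = (1 - q ^ 2) ^ (1 - (s + 1)) * (1 - q ^ 2) := by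
    rw [← Real.rpow_add_one (by linarith)]; ring_nf
  rw [e3]
  have h2 : 1 - q ^ 2 ≠ 0 := by linarith
  simp only [mul_inv, div_eq_mul_inv]
  field_simp

noncomputable def auxT (q ν z : ℝ) (k : ℕ) : ℝ :=
  (1 - q ^ 2) ^ k * (z / 2) ^ (ν + 2 * (k : ℝ)) /
    (qPochR (q ^ 2) (q ^ 2) k * qGamma2 q (ν + k + 1))

lemma auxE (q ν : ℝ) (hq0 : 0 < q) (k : ℕ) :
    q ^ (2 * (ν + k + 1)) = (q ^ ν) ^ 2 * (q ^ 2) ^ k * q ^ 2 := by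
  rw [← pow_mul, ← Real.rpow_natCast q 2, ← Real.rpow_natCast q (2 * k), ← Real.rpow_natCast _ 2,
    ← Real.rpow_mul hq0.le, ← Real.rpow_add hq0, ← Real.rpow_add hq0]
  congr 1; push_cast; ring

lemma auxT_succ (q ν z : ℝ) (hq0 : 0 < q) (hq1 : q < 1) (hz : 0 < z)
    (k : ℕ) (hs : ν + k + 1 ≠ 0) :
    auxT q ν z (k + 1) = (1 - q ^ 2) ^ 2 * (z / 2) ^ 2 /
      ((1 - (q ^ 2) ^ k * q ^ 2) * (1 - (q ^ ν) ^ 2 * (q ^ 2) ^ k * q ^ 2)) * auxT q ν z k := by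
  unfold auxT
  have e1 : ν + ((k + 1 : ℕ) : ℝ) + 1 = (ν + k + 1) + 1 := by push_cast; ring
  have e2 : (z / 2) ^ (ν + 2 * ((k + 1 : ℕ) : ℝ)) = (z / 2) ^ (ν + 2 * (k : ℝ)) * (z / 2) ^ 2 := by
    rw [← Real.rpow_natCast (z / 2) 2, ← Real.rpow_add (by positivity)]
    congr 1; push_cast; ring
  have e3 : qPochR (q ^ 2) (q ^ 2) (k + 1) =
      qPochR (q ^ 2) (q ^ 2) k * (1 - (q ^ 2) ^ k * q ^ 2) := by
    unfold qPochR
    rw [Finset.prod_range_succ]; ring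
  rw [e1, e2, e3]
  simp only [div_eq_mul_inv _ (_ * qGamma2 _ _), mul_inv _ (qGamma2 _ _)]
  rw [aux_gamma q _ hq0 hq1 hs, auxE q ν hq0]
  simp only [div_eq_mul_inv, mul_inv, pow_succ]
  ring

lemma auxT_summable (q ν z : ℝ) (hq0 : 0 < q) (hq1 : q < 1) (hz : 0 < z)
    (hs : ∀ k : ℕ, ν + k + 1 ≠ 0) (hz1 : (1 - q ^ 2) * (z / 2) < 1) :
    Summable (auxT q ν z) := by
  have hq2 : q ^ 2 < 1 := by nlinarith
  have hp : Filter.Tendsto (fun k : ℕ => (q ^ 2) ^ k) Filter.atTop (nhds 0) :=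
    tendsto_pow_atTop_nhds_zero_of_lt_one (by positivity) hq2
  have hlim : Filter.Tendsto (fun k : ℕ => |(1 - q ^ 2) ^ 2 * (z / 2) ^ 2 /
      ((1 - (q ^ 2) ^ k * q ^ 2) * (1 - (q ^ ν) ^ 2 * (q ^ 2) ^ k * q ^ 2))|) Filter.atTop
      (nhds |(1 - q ^ 2) ^ 2 * (z / 2) ^ 2 /
      ((1 - 0 * q ^ 2) * (1 - (q ^ ν) ^ 2 * 0 * q ^ 2))|) := by
    refine Filter.Tendsto.abs (Filter.Tendsto.div tendsto_const_nhds ?_ (by simp))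
    exact (tendsto_const_nhds.sub (hp.mul_const _)).mul
      (tendsto_const_nhds.sub ((hp.const_mul _).mul_const _))
  have hD : |(1 - q ^ 2) ^ 2 * (z / 2) ^ 2 /
      ((1 - 0 * q ^ 2) * (1 - (q ^ ν) ^ 2 * 0 * q ^ 2))| < 1 := by
    have h0 : 0 < (1 - q ^ 2) * (z / 2) := mul_pos (by linarith) (by positivity)
    have : (1 - q ^ 2) ^ 2 * (z / 2) ^ 2 /
      ((1 - 0 * q ^ 2) * (1 - (q ^ ν) ^ 2 * 0 * q ^ 2)) = ((1 - q ^ 2) * (z / 2)) ^ 2 := by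
      simp; ring
    rw [this, abs_of_pos (by positivity)]
    nlinarith
  obtain ⟨r, hr, hr1⟩ := exists_between hD
  refine summable_of_ratio_norm_eventually_le hr1 ?_
  filter_upwards [hlim.eventually_lt_const hr] with k hk
  rw [auxT_succ q ν z hq0 hq1 hz k (hs k), norm_mul]
  exact mul_le_mul_of_nonneg_right hk.le (norm_nonneg _)

lemma auxT_scale (q ν z : ℝ) (hq0 : 0 < q) (hz : 0 < z) (k : ℕ) :
    auxT q ν (q * z) k = q ^ ν * (q ^ 2) ^ k * auxT q ν z k := by
  unfold auxT
  have : (q * z / 2) ^ (ν + 2 * (k : ℝ)) = q ^ ν * (q ^ 2) ^ k * (z / 2) ^ (ν + 2 * (k : ℝ)) := by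
    rw [mul_div_assoc, Real.mul_rpow hq0.le (by positivity), Real.rpow_add hq0, ← pow_mul,
      ← Real.rpow_natCast q (2 * k)]
    push_cast; rfl
  rw [this]; ring

/-- `f(z) = I^{(1)}_ν((1-q²)z;q²)` satisfies the q-difference equation (3.11):
`[1 - q^{-2}(1-q²)²z²/4] f(q^{-1}z) - (q^{-ν}+q^ν) f(z) + f(qz) = 0`. -/
theorem stmt9 (q : ℝ) (hq0 : 0 < q) (hq1 : q < 1) (ν : ℝ)
    (h1 : ∀ m : ℤ, m < 0 → ν ≠ m)
    (z : ℝ) (hz0 : 0 < z) (hz : z < 2 * q / (1 - q ^ 2)) :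
    (1 - q ^ (-2 : ℤ) * (1 - q ^ 2) ^ 2 * z ^ 2 / 4) * I1 q ν (q⁻¹ * z)
      - (q ^ (-ν) + q ^ ν) * I1 q ν z + I1 q ν (q * z) = 0 := by
  have hq2 : q ^ 2 < 1 := by nlinarith
  have hs : ∀ k : ℕ, ν + k + 1 ≠ 0 := by
    intro k hk
    refine h1 (-(k + 1 : ℤ)) (by omega) ?_
    push_cast; linarith
  have hzq : z * (1 - q ^ 2) < 2 * q := (lt_div_iff₀ (by linarith)).1 hz
  obtain ⟨w, rfl⟩ : ∃ w, z = q * w := ⟨q⁻¹ * z, by field_simp⟩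
  have hw : 0 < w := pos_of_mul_pos_right hz0 hq0.le
  have hw1 : (1 - q ^ 2) * (w / 2) < 1 := by
    have : q * (w * (1 - q ^ 2)) < q * 2 := by linarith
    have := lt_of_mul_lt_mul_left this hq0.le
    linarith
  have hI : ∀ x, I1 q ν x = ∑' k, auxT q ν x k := fun x => rfl
  have hS1 := auxT_summable q ν w hq0 hq1 hw hs hw1
  have hqw : q * w < w := by nlinarith
  have hS2 := auxT_summable q ν (q * w) hq0 hq1 hz0 hs (by nlinarith)
  have hS3 := auxT_summable q ν (q * (q * w)) hq0 hq1 (by positivity) hs (by nlinarith)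
  have hu : 0 < q ^ ν := Real.rpow_pos_of_pos hq0 ν
  rw [inv_mul_cancel_left₀ hq0.ne', hI, hI, hI, Real.rpow_neg hq0.le]
  have hg := (hS1.sub (hS2.mul_left ((q ^ ν)⁻¹ + q ^ ν))).add hS3
  have key := hg.tsum_eq_zero_add
  rw [(hS1.sub (hS2.mul_left _)).tsum_add hS3, hS1.tsum_sub (hS2.mul_left _), tsum_mul_left] at key
  have h0 : auxT q ν w 0 - ((q ^ ν)⁻¹ + q ^ ν) * auxT q ν (q * w) 0
      + auxT q ν (q * (q * w)) 0 = 0 := by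
    rw [auxT_scale q ν (q * w) hq0 hz0, auxT_scale q ν w hq0 hw]
    field_simp
    ring
  have hk : ∀ k : ℕ, auxT q ν w (k + 1) - ((q ^ ν)⁻¹ + q ^ ν) * auxT q ν (q * w) (k + 1)
      + auxT q ν (q * (q * w)) (k + 1) = (1 - q ^ 2) ^ 2 * (w / 2) ^ 2 * auxT q ν w k := by
    intro k
    rw [auxT_scale q ν (q * w) hq0 hz0, auxT_scale q ν w hq0 hw,
      auxT_succ q ν w hq0 hq1 hw k (hs k)]
    have n1 : 1 - (q ^ 2) ^ k * q ^ 2 ≠ 0 := by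
      have : (q ^ 2) ^ k ≤ 1 := pow_le_one₀ (by positivity) hq2.le
      nlinarith
    have n2 : 1 - (q ^ ν) ^ 2 * (q ^ 2) ^ k * q ^ 2 ≠ 0 := by
      rw [← auxE q ν hq0]
      intro h
      have h' : q ^ (2 * (ν + k + 1)) = 1 := by linarith
      exact hs k (by linarith [aux_one q _ hq0 hq1 h'])
    rw [pow_succ (q ^ 2) k]
    generalize (q ^ 2) ^ k = p at *
    generalize q ^ ν = u at *
    generalize auxT q ν w k = T at *
    have n3 := hu.ne'
    have hX := mul_div_cancel₀ ((1 - q ^ 2) ^ 2 * (w / 2) ^ 2) (mul_ne_zero n1 n2)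
    have hi := mul_inv_cancel₀ n3
    generalize (1 - q ^ 2) ^ 2 * (w / 2) ^ 2 / ((1 - p * q ^ 2) * (1 - u ^ 2 * p * q ^ 2)) = X at *
    linear_combination T * hX - p * q ^ 2 * X * T * hi
  rw [h0, zero_add, tsum_congr hk, tsum_mul_left] at key
  have hc : q ^ (-2 : ℤ) * (1 - q ^ 2) ^ 2 * (q * w) ^ 2 / 4 = (1 - q ^ 2) ^ 2 * (w / 2) ^ 2 := by
    rw [show (-2 : ℤ) = -((2 : ℕ) : ℤ) by norm_num, zpow_neg, zpow_natCast]
    field_simp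
    ring
  rw [hc]
  linarith
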